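/- Let p be a large enough prime and let j be a prime with 2 < j < p − 2. Then the bivariate polynomial (P_j(x) − P_j(y))/(x − y) ∈ F_p[x,y] is absolutely irreducible over F_p, where P_j(x) = ∏_{i=1}^{j} (x+i). -/

import Mathlib

open MvPolynomial

/-- `P_j(x) = ∏_{i=1}^{j} (x + i)` over `ZMod p`. -/
noncomputable def Pfact (p j : ℕ) : Polynomial (ZMod p) :=
  ∏ i ∈ Finset.Icc 1 j, (Polynomial.X + Polynomial.C (i : ZMod p))

namespace Polynomial

open Polynomial

/-- Difference operator attached to a finite set of shifts. -/
noncomputable def shiftDiff {j : ℕ} (U : Finset (ZMod j)) (Q : (ZMod j)[X]) : (ZMod j)[X] :=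
  ∑ u ∈ U, (taylor u Q - Q)

theorem shiftDiff_eval {j : ℕ} (U : Finset (ZMod j)) (Q : (ZMod j)[X]) (a : ZMod j) :
    (shiftDiff U Q).eval a = ∑ u ∈ U, (Q.eval (a + u) - Q.eval a) := by
  simp [shiftDiff, eval_finsetSum, taylor_eval]

theorem shiftDiff_natDegree_le {j : ℕ} [Fact j.Prime] (U : Finset (ZMod j)) (Q : (ZMod j)[X]) :
    (shiftDiff U Q).natDegree ≤ Q.natDegree := by
  refine natDegree_sum_le_of_forall_le _ _ fun u _ => ?_
  refine (natDegree_sub_le _ _).trans ?_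
  simp

theorem shiftDiff_coeff {j : ℕ} [Fact j.Prime] (U : Finset (ZMod j)) (Q : (ZMod j)[X]) {r : ℕ}
    (hr : 1 ≤ r) (hz : ∀ k, 1 ≤ k → k < r → ∑ u ∈ U, u ^ k = 0) (hn : r ≤ Q.natDegree) :
    (shiftDiff U Q).coeff (Q.natDegree - r) =
      (Q.natDegree.choose (Q.natDegree - r) : ZMod j) * Q.leadingCoeff * ∑ u ∈ U, u ^ r := by
  set n := Q.natDegree with hnd
  have key : ∀ u : ZMod j, (taylor u Q - Q).coeff (n - r) = ∑ k ∈ Finset.range r,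
      ((k + 1 + (n - r)).choose (n - r) : ZMod j) * Q.coeff (k + 1 + (n - r)) * u ^ (k + 1) := by
    intro u
    have hd : (hasseDeriv (n - r) Q).natDegree < r + 1 := by
      have := natDegree_hasseDeriv_le Q (n - r)
      omega
    rw [coeff_sub, taylor_coeff, eval_eq_sum_range' hd, Finset.sum_range_succ']
    simp [hasseDeriv_coeff]
  rw [shiftDiff, finsetSum_coeff, Finset.sum_congr rfl fun u _ => key u, Finset.sum_comm]
  simp_rw [← Finset.mul_sum]
  obtain ⟨q, rfl⟩ : ∃ q, r = q + 1 := ⟨r - 1, by omega⟩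
  rw [Finset.sum_range_succ, Finset.sum_eq_zero, zero_add]
  · rw [show q + 1 + (n - (q + 1)) = n by omega]; rfl
  · intro k hk
    rw [Finset.mem_range] at hk
    rw [hz (k + 1) (by omega) (by omega), mul_zero]

theorem natDegree_le_of_shiftDiff {j : ℕ} [Fact j.Prime] (U : Finset (ZMod j)) (Q : (ZMod j)[X])
    {r : ℕ} (hr : 1 ≤ r) (hz : ∀ k, 1 ≤ k → k < r → ∑ u ∈ U, u ^ k = 0)
    (hr0 : ∑ u ∈ U, u ^ r ≠ 0) (hQ : Q.natDegree < j) (c : ZMod j)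
    (h : ∀ a, ∑ u ∈ U, (Q.eval (a + u) - Q.eval a) = c) (hn : r ≤ Q.natDegree) :
    c ≠ 0 ∧ Q.natDegree = r := by
  have hj : j.Prime := Fact.out
  have hC : shiftDiff U Q = C c := by
    apply Polynomial.eq_of_natDegree_lt_card_of_eval_eq' _ _ (Finset.univ : Finset (ZMod j))
    · intro a _; rw [shiftDiff_eval, h, eval_C]
    · rw [Finset.card_univ, ZMod.card]
      simpa using lt_of_le_of_lt (shiftDiff_natDegree_le U Q) hQ
  have h1 := shiftDiff_coeff U Q hr hz hn
  have hne : (Q.natDegree.choose (Q.natDegree - r) : ZMod j) * Q.leadingCoeff * ∑ u ∈ U, u ^ r ≠ 0 := by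
    refine mul_ne_zero (mul_ne_zero ?_ ?_) hr0
    · rw [Ne, ZMod.natCast_eq_zero_iff]
      intro hd
      have := hj.coprime_choose_of_lt hQ (Nat.sub_le Q.natDegree r)
      exact (Nat.Prime.coprime_iff_not_dvd hj).1 this hd
    · rw [leadingCoeff_ne_zero]; rintro rfl; simp at hn; omega
  rw [← h1, hC, coeff_C] at hne
  split_ifs at hne with h0
  · exact ⟨hne, by omega⟩
  · exact absurd rfl hne

theorem exists_powerSum_ne_zero {R : Type*} [CommRing R] [IsDomain R] (U : Finset R) (h0 : (0 : R) ∉ U)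
    (hU : U.Nonempty) : ∃ r, 1 ≤ r ∧ r ≤ U.card ∧ ∑ u ∈ U, u ^ r ≠ 0 := by
  by_contra! hc
  let f : Fin U.card → R := fun i => (U.equivFin.symm i : R)
  have hf : Function.Injective f := Subtype.val_injective.comp U.equivFin.symm.injective
  have := Matrix.eq_zero_of_forall_pow_sum_mul_pow_eq_zero (f := f) (v := f) hf (fun k => by
    simp_rw [← pow_succ']
    rw [← hc (k + 1) (by omega) (by omega), ← Finset.sum_coe_sort U]
    exact Equiv.sum_comp U.equivFin.symm (fun u => (u : R) ^ (k + 1 : ℕ)))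
  obtain ⟨u, hu⟩ := hU
  have h2 := congrFun this (U.equivFin ⟨u, hu⟩)
  simp [f] at h2
  exact h0 (h2 ▸ hu)

/-- A permutation of `ZMod j` preserving a small Cayley digraph is affine. -/
theorem perm_affine {j : ℕ} [Fact j.Prime] (U : Finset (ZMod j)) (h0 : (0 : ZMod j) ∉ U)
    (hU : U.Nonempty) (hcard : 2 * U.card ≤ j - 1) (π : Equiv.Perm (ZMod j))
    (hπ : ∀ a b, b - a ∈ U → π b - π a ∈ U) : ∃ u v : ZMod j, ∀ i, π i = u * i + v := by
  classical
  have hj : j.Prime := Fact.out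
  have hsum : ∀ (m : ℕ) (a : ZMod j), ∑ u ∈ U, (π (a + u)) ^ m = ∑ u ∈ U, (π a + u) ^ m := by
    intro m a
    have himg : U.image (fun u => π (a + u) - π a) = U := by
      apply Finset.eq_of_subset_of_card_le
      · intro y hy
        obtain ⟨u, hu, rfl⟩ := Finset.mem_image.1 hy
        exact hπ _ _ (by simpa using hu)
      · rw [Finset.card_image_of_injective]
        intro u v huv
        simpa using huv
    conv_rhs => rw [← himg]
    rw [Finset.sum_image]
    · simp
    · intro u _ v _ huv
      simpa using huv
  have hex : ∃ r, 1 ≤ r ∧ ∑ u ∈ U, u ^ r ≠ 0 := by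
    obtain ⟨r, h1, -, h2⟩ := exists_powerSum_ne_zero U h0 hU
    exact ⟨r, h1, h2⟩
  set r := Nat.find hex with hrdef
  obtain ⟨hr1, hr0⟩ := Nat.find_spec hex
  rw [← hrdef] at hr1 hr0
  have hz : ∀ k, 1 ≤ k → k < r → ∑ u ∈ U, u ^ k = 0 := by
    intro k hk hkr
    by_contra hne
    exact Nat.find_min hex hkr ⟨hk, hne⟩
  have hrle : r ≤ U.card := by
    obtain ⟨r', h1, h2, h3⟩ := exists_powerSum_ne_zero U h0 hU
    exact (Nat.find_min' hex ⟨h1, h3⟩).trans h2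
  obtain ⟨P, hPd, hP⟩ : ∃ P : (ZMod j)[X], P.natDegree < j ∧ ∀ i, P.eval i = π i := by
    refine ⟨Lagrange.interpolate Finset.univ id π, ?_, fun i => ?_⟩
    · have := Lagrange.degree_interpolate_lt (s := Finset.univ) (v := id) π
        (Set.injOn_of_injective Function.injective_id)
      rw [Finset.card_univ, ZMod.card] at this
      by_cases hP0 : Lagrange.interpolate Finset.univ id π = 0
      · rw [hP0]; simpa using hj.pos
      · rwa [natDegree_lt_iff_degree_lt hP0]
    · exact Lagrange.eval_interpolate_at_node (v := id) π
        (Set.injOn_of_injective Function.injective_id) (Finset.mem_univ i)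
  have hpow : ∀ k < r, ∀ a, ∑ u ∈ U, ((P ^ k).eval (a + u) - (P ^ k).eval a) = 0 := by
    intro k hk a
    simp only [eval_pow, hP, Finset.sum_sub_distrib, hsum]
    rw [← Finset.sum_sub_distrib]
    have : ∀ u : ZMod j, (π a + u) ^ k - π a ^ k =
        ∑ m ∈ Finset.range k, u ^ (m + 1) * (π a ^ (k - (m + 1)) * (k.choose (m + 1))) := by
      intro u
      rw [add_comm (π a) u, add_pow, Finset.sum_range_succ']
      simp [mul_assoc]
    rw [Finset.sum_congr rfl fun u _ => this u, Finset.sum_comm]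
    refine Finset.sum_eq_zero fun m hm => ?_
    rw [Finset.mem_range] at hm
    rw [← Finset.sum_mul, hz (m + 1) (by omega) (by omega), zero_mul]
  have hdeg : P.natDegree ≤ 1 := by
    rcases eq_or_lt_of_le hr1 with h1 | h1
    · by_contra! hlt
      have := natDegree_le_of_shiftDiff U P hr1 hz hr0 hPd (∑ u ∈ U, u) (fun a => by
        have := hsum 1 a
        simp only [pow_one] at this
        simp only [hP, Finset.sum_sub_distrib, this]
        rw [← Finset.sum_sub_distrib]
        simp) (by omega)
      omega
    · by_contra! hlt
      have hk : ∀ k < r, k * P.natDegree < j → k * P.natDegree < r := by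
        intro k hk hkj
        by_contra! hle
        have := natDegree_le_of_shiftDiff U (P ^ k) hr1 hz hr0 (by rwa [natDegree_pow]) 0
          (hpow k hk) (by rwa [natDegree_pow])
        exact this.1 rfl
      have hall : ∀ k < r, k * P.natDegree < r := by
        intro k
        induction k with
        | zero => intro _; omega
        | succ k ih =>
          intro hkr
          have h3 := ih (by omega)
          have h4 := hk 1 h1 (by omega)
          exact hk _ hkr (by rw [add_mul]; omega)
      have h5 := hall (r - 1) (by omega)
      have h6 : (r - 1) * 2 ≤ (r - 1) * P.natDegree := Nat.mul_le_mul_left _ hlt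
      omega
  refine ⟨P.coeff 1, P.coeff 0, fun i => ?_⟩
  rw [← hP, eq_X_add_C_of_natDegree_le_one hdeg]
  simp

theorem map_sub_C_eq_prod {K E ι : Type*} [Field K] [Field E] [Algebra K E] [Fintype ι] {T : E}
    {F : K[X]} (hF : F.Monic) (hpos : 0 < F.natDegree) {x : ι → E}
    (hx : Function.Injective x) (hroot : ∀ i, aeval (x i) F = T)
    (hcard : Fintype.card ι = F.natDegree) :
    F.map (algebraMap K E) - C T = ∏ i, (X - C (x i)) := by
  have hdeg : (C T).degree < (F.map (algebraMap K E)).degree := by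
    rw [degree_map]
    exact lt_of_le_of_lt degree_C_le (natDegree_pos_iff_degree_pos.1 hpos)
  have hm : (F.map (algebraMap K E) - C T).Monic := (hF.map _).sub_of_left hdeg
  have hnd : (F.map (algebraMap K E) - C T).natDegree = F.natDegree := by
    rw [natDegree_sub_C, natDegree_map]
  refine eq_of_monic_of_dvd_of_natDegree_le (monic_prod_X_sub_C _ _) hm ?_ ?_
  · refine Finset.prod_dvd_of_coprime ?_ ?_
    · intro i _ k _ hik
      exact isCoprime_X_sub_C_of_isUnit_sub (sub_ne_zero.2 (hx.ne hik)).isUnit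
    · intro i _
      rw [dvd_iff_isRoot]
      simp [eval_map_algebraMap, hroot]
  · rw [hnd, natDegree_prod_of_monic _ _ fun i _ => monic_X_sub_C _]
    simp [hcard]

open IntermediateField.algebraAdjoinAdjoin in
open scoped IntermediateField in
theorem exists_aeval_eq_of_perm_invariant {K E ι : Type*} [Field K] [Field E] [Algebra K E]
    [Fintype ι] {T : E} (hT : Transcendental K T) {F : K[X]} (hF : F.Monic)
    (hpos : 0 < F.natDegree) {x : ι → E} (hx : Function.Injective x)
    (hroot : ∀ i, aeval (x i) F = T) (hcard : Fintype.card ι = F.natDegree)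
    (P : MvPolynomial ι K)
    (hP : ∀ π : Equiv.Perm ι, (∀ Q : MvPolynomial ι K,
        MvPolynomial.aeval x Q = 0 ↔ MvPolynomial.aeval (x ∘ π) Q = 0) →
      MvPolynomial.aeval (x ∘ π) P = MvPolynomial.aeval x P) :
    ∃ q : K[X], MvPolynomial.aeval x P = aeval T q := by
  have hprod := map_sub_C_eq_prod hF hpos hx hroot hcard
  let q : K⟮T⟯[X] := F.map (algebraMap K K⟮T⟯) - C (IntermediateField.AdjoinSimple.gen K T)
  have hq : q.map (algebraMap K⟮T⟯ E) = ∏ i, (X - C (x i)) := by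
    rw [← hprod]
    simp [q, Polynomial.map_map, ← IsScalarTower.algebraMap_eq]
  have hq0 : q ≠ 0 := by
    intro h0
    rw [h0, Polynomial.map_zero] at hq
    exact (monic_prod_X_sub_C x Finset.univ).ne_zero hq.symm
  have hspl : (q.map (algebraMap K⟮T⟯ E)).Splits := by
    rw [hq]
    exact Splits.prod fun i _ => Splits.X_sub_C _
  have hsep : q.Separable := by
    rw [← separable_map (algebraMap K⟮T⟯ E), hq]
    exact separable_prod_X_sub_C_iff.2 hx
  have hrs : ∀ y : E, y ∈ q.rootSet E ↔ ∃ i, x i = y := by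
    intro y
    rw [mem_rootSet, ← eval_map_algebraMap, hq, eval_prod, Finset.prod_eq_zero_iff]
    simp [hq0, sub_eq_zero, eq_comm]
  let M := IntermediateField.adjoin K⟮T⟯ (q.rootSet E)
  have : IsSplittingField K⟮T⟯ M q := IntermediateField.adjoin_rootSet_isSplittingField hspl
  have : IsGalois K⟮T⟯ M := IsGalois.of_separable_splitting_field hsep
  have : FiniteDimensional K⟮T⟯ M := IsSplittingField.finiteDimensional M q
  let y : ι → M := fun i => ⟨x i, IntermediateField.subset_adjoin _ _ ((hrs _).2 ⟨i, rfl⟩)⟩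
  let incl : M →ₐ[K] E := M.val.restrictScalars K
  have hincl : Function.Injective incl := Subtype.val_injective
  have hx1 : ∀ Q : MvPolynomial ι K, MvPolynomial.aeval x Q = incl (MvPolynomial.aeval y Q) := by
    intro Q
    rw [MvPolynomial.comp_aeval_apply]
    rfl
  have hfix : ∀ σ : M ≃ₐ[K⟮T⟯] M, σ (MvPolynomial.aeval y P) = MvPolynomial.aeval y P := by
    intro σ
    let τ : M →ₐ[K] M := (σ : M →ₐ[K⟮T⟯] M).restrictScalars K
    have hτ : Function.Injective τ := σ.injective
    have h1 : ∀ i, ∃ k, x k = incl (τ (y i)) := by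
      intro i
      rw [← hrs, mem_rootSet]
      refine ⟨hq0, ?_⟩
      change aeval (M.val (σ (y i))) q = 0
      rw [aeval_algHom_apply, show σ (y i) = (σ : M →ₐ[K⟮T⟯] M) (y i) from rfl, aeval_algHom_apply]
      have : aeval (y i) q = 0 := by
        apply hincl
        rw [map_zero]
        change M.val (aeval (y i) q) = 0
        rw [← aeval_algHom_apply M.val]
        exact (mem_rootSet.1 ((hrs (x i)).2 ⟨i, rfl⟩)).2
      rw [this, map_zero, map_zero]
    choose π hπ using h1
    have hπi : Function.Injective π := by
      intro a b hab
      have : incl (τ (y a)) = incl (τ (y b)) := by rw [← hπ, ← hπ, hab]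
      have := hτ (hincl this)
      exact hx (congrArg Subtype.val this)
    let π' : Equiv.Perm ι := Equiv.ofBijective π (Finite.injective_iff_bijective.1 hπi)
    have hx2 : ∀ Q : MvPolynomial ι K, MvPolynomial.aeval (x ∘ π') Q = incl (τ (MvPolynomial.aeval y Q)) := by
      intro Q
      rw [MvPolynomial.comp_aeval_apply, MvPolynomial.comp_aeval_apply]
      congr 2
      funext i
      exact hπ i
    have h2 := hP π' (fun Q => by
      rw [hx1, hx2, map_eq_zero_iff _ hincl, map_eq_zero_iff _ hincl, map_eq_zero_iff _ hτ])
    rw [hx1, hx2] at h2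
    exact hincl h2
  obtain ⟨c, hc⟩ := (IsGalois.mem_range_algebraMap_iff_fixed _).2 hfix
  have hcE : algebraMap K⟮T⟯ E c = MvPolynomial.aeval x P := by
    have := congrArg incl hc
    rw [← hx1] at this
    exact this
  let A := Algebra.adjoin K {T}
  have : IsIntegrallyClosed A := by
    have e : K[X] ≃ₐ[K] A := (AlgEquiv.ofInjective (aeval T)
      (transcendental_iff_injective.1 hT)).trans
        (Subalgebra.equivOfEq _ _ (Algebra.adjoin_singleton_eq_range_aeval K T).symm)
    exact IsIntegrallyClosed.of_equiv e.toRingEquiv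
  have hint : IsIntegral A c := by
    rw [← isIntegral_algebraMap_iff (algebraMap K⟮T⟯ E).injective, hcE]
    have hxi : ∀ i, IsIntegral A (x i) := by
      intro i
      refine ⟨F.map (algebraMap K A) - C ⟨T, Algebra.self_mem_adjoin_singleton K T⟩, ?_, ?_⟩
      · refine (hF.map _).sub_of_left ?_
        rw [degree_map]
        exact lt_of_le_of_lt degree_C_le (natDegree_pos_iff_degree_pos.1 hpos)
      · rw [eval₂_sub, eval₂_map, eval₂_C, ← IsScalarTower.algebraMap_eq, sub_eq_zero]
        exact hroot i
    have hall : ∀ Q : MvPolynomial ι K, IsIntegral A (MvPolynomial.aeval x Q) := by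
      intro Q
      induction Q using MvPolynomial.induction_on with
      | C a =>
        rw [MvPolynomial.aeval_C, IsScalarTower.algebraMap_apply K A E]
        exact isIntegral_algebraMap
      | add p q hp hq => rw [map_add]; exact hp.add hq
      | mul_X p i hp => rw [map_mul, MvPolynomial.aeval_X]; exact hp.mul (hxi i)
    exact hall P
  obtain ⟨b, hb⟩ := IsIntegrallyClosed.isIntegral_iff.1 hint
  have hbT : (b : E) ∈ (aeval T : K[X] →ₐ[K] E).range := by
    rw [← Algebra.adjoin_singleton_eq_range_aeval]
    exact b.2
  obtain ⟨r, hr⟩ := hbT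
  refine ⟨r, ?_⟩
  rw [← hcE, ← hb]
  exact hr.symm

theorem finSuccEquiv_aeval_sub {K : Type*} [Field K] (F : K[X]) :
    MvPolynomial.finSuccEquiv K 1 (aeval (MvPolynomial.X 0) F - aeval (MvPolynomial.X 1) F) =
      F.map (algebraMap K (MvPolynomial (Fin 1) K)) - C (aeval (MvPolynomial.X 0) F) := by
  have h1 : MvPolynomial.finSuccEquiv K 1 (aeval (MvPolynomial.X 0) F) =
      F.map (algebraMap K (MvPolynomial (Fin 1) K)) := by
    rw [← aeval_algHom_apply, MvPolynomial.finSuccEquiv_X_zero, aeval_X_left_eq_map]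
  have h2 : MvPolynomial.finSuccEquiv K 1 (aeval (MvPolynomial.X 1) F) =
      C (aeval (MvPolynomial.X 0) F) := by
    rw [← aeval_algHom_apply, show (1 : Fin 2) = Fin.succ 0 from rfl,
      MvPolynomial.finSuccEquiv_X_succ]
    exact aeval_algebraMap_apply _ _ _
  rw [map_sub, h1, h2]

/-- A factor of the difference quotient is monic in the first variable, up to a unit. -/
theorem isUnit_leadingCoeff_of_factor {K : Type*} [Field K] {F : K[X]} (hF : F.Monic)
    (hpos : 0 < F.natDegree) {A B : MvPolynomial (Fin 2) K}
    (hAB : A * B = aeval (MvPolynomial.X 0) F - aeval (MvPolynomial.X 1) F) :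
    IsUnit (MvPolynomial.finSuccEquiv K 1 A).leadingCoeff := by
  have hm : (MvPolynomial.finSuccEquiv K 1 (A * B)).Monic := by
    rw [hAB, finSuccEquiv_aeval_sub]
    refine (hF.map _).sub_of_left ?_
    rw [degree_map_eq_of_injective (algebraMap K (MvPolynomial (Fin 1) K)).injective]
    exact lt_of_le_of_lt degree_C_le (natDegree_pos_iff_degree_pos.1 hpos)
  rw [map_mul, Monic, leadingCoeff_mul] at hm
  exact IsUnit.of_mul_eq_one _ hm

theorem natDegree_pos_of_factor {K : Type*} [Field K] {F : K[X]} (hF : F.Monic)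
    (hpos : 0 < F.natDegree) {A B : MvPolynomial (Fin 2) K}
    (hAB : A * B = aeval (MvPolynomial.X 0) F - aeval (MvPolynomial.X 1) F) (hA : ¬ IsUnit A) :
    0 < (MvPolynomial.finSuccEquiv K 1 A).natDegree := by
  by_contra! h0
  have hu := isUnit_leadingCoeff_of_factor hF hpos hAB
  rw [leadingCoeff, Nat.le_zero.1 h0] at hu
  apply hA
  rw [← MulEquiv.isUnit_map (MvPolynomial.finSuccEquiv K 1),
    eq_C_of_natDegree_le_zero h0]
  exact hu.map C

theorem eval_aeval_pair {K E : Type*} [Field K] [Field E] [Algebra K E] (r y : E)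
    (A : MvPolynomial (Fin 2) K) :
    (MvPolynomial.aeval ![X, C y] A).eval r = MvPolynomial.aeval ![r, y] A := by
  have h : ((aeval r).restrictScalars K).comp (MvPolynomial.aeval ![X, C y]) =
      (MvPolynomial.aeval ![r, y] : MvPolynomial (Fin 2) K →ₐ[K] E) := by
    ext i
    fin_cases i <;> simp
  rw [← h]
  simp [coe_aeval_eq_eval]

theorem aeval_pair_mul {K E ι : Type*} [Field K] [Field E] [Algebra K E] [Fintype ι] {T : E}
    {F : K[X]} (hF : F.Monic) (hpos : 0 < F.natDegree) {x : ι → E}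
    (hx : Function.Injective x) (hroot : ∀ i, aeval (x i) F = T)
    (hcard : Fintype.card ι = F.natDegree)
    {A B : MvPolynomial (Fin 2) K}
    (hAB : A * B * (MvPolynomial.X 0 - MvPolynomial.X 1) =
      aeval (MvPolynomial.X 0) F - aeval (MvPolynomial.X 1) F) (i₀ : ι) :
    MvPolynomial.aeval ![X, C (x i₀)] A * (MvPolynomial.aeval ![X, C (x i₀)] B *
      (X - C (x i₀))) = ∏ i, (X - C (x i)) := by
  rw [← map_sub_C_eq_prod hF hpos hx hroot hcard]
  have := congrArg (MvPolynomial.aeval (R := K) ![X, C (x i₀)]) hAB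
  simp only [map_mul, map_sub, ← aeval_algHom_apply, MvPolynomial.aeval_X] at this
  rw [mul_assoc] at this
  simp only [Matrix.cons_val_zero, Matrix.cons_val_one] at this
  rw [this, aeval_X_left_eq_map, ← hroot i₀]
  congr 1
  exact aeval_algebraMap_apply _ _ _

theorem ne_of_aeval_pair_eq_zero {K E ι : Type*} [Field K] [Field E] [Algebra K E] [Fintype ι] {T : E}
    {F : K[X]} (hF : F.Monic) (hpos : 0 < F.natDegree) {x : ι → E}
    (hx : Function.Injective x) (hroot : ∀ i, aeval (x i) F = T)
    (hcard : Fintype.card ι = F.natDegree)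
    {A B : MvPolynomial (Fin 2) K}
    (hAB : A * B * (MvPolynomial.X 0 - MvPolynomial.X 1) =
      aeval (MvPolynomial.X 0) F - aeval (MvPolynomial.X 1) F) {i₀ s : ι}
    (hA : MvPolynomial.aeval ![x s, x i₀] A = 0) :
    s ≠ i₀ ∧ MvPolynomial.aeval ![x s, x i₀] B ≠ 0 := by
  have hprod := aeval_pair_mul hF hpos hx hroot hcard hAB i₀
  have hsep : (∏ i, (X - C (x i))).Separable := separable_prod_X_sub_C_iff.2 hx
  rw [← hprod] at hsep
  obtain ⟨a, b, hab⟩ := hsep.isCoprime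
  have h := congrArg (eval (x s)) hab
  simp only [eval_add, eval_mul, eval_aeval_pair, hA, mul_zero, zero_add, eval_sub, eval_X,
    eval_C, eval_one] at h
  constructor
  · rintro rfl
    simp at h
  · intro h0
    simp [h0] at h

theorem exists_aeval_pair_eq_zero {K E ι : Type*} [Field K] [Field E] [Algebra K E] [Fintype ι] {T : E}
    {F : K[X]} (hF : F.Monic) (hpos : 0 < F.natDegree) {x : ι → E}
    (hx : Function.Injective x) (hroot : ∀ i, aeval (x i) F = T)
    (hcard : Fintype.card ι = F.natDegree)
    {A B : MvPolynomial (Fin 2) K}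
    (hAB : A * B * (MvPolynomial.X 0 - MvPolynomial.X 1) =
      aeval (MvPolynomial.X 0) F - aeval (MvPolynomial.X 1) F) (i₀ : ι) (hA : ¬ IsUnit A) :
    ∃ s, MvPolynomial.aeval ![x s, x i₀] A = 0 := by
  have hprod := aeval_pair_mul hF hpos hx hroot hcard hAB i₀
  have hd := natDegree_pos_of_factor hF hpos ((mul_assoc _ _ _).symm.trans hAB) hA
  have hu := isUnit_leadingCoeff_of_factor hF hpos ((mul_assoc _ _ _).symm.trans hAB)
  let θ : MvPolynomial (Fin 1) K →ₐ[K] E := MvPolynomial.aeval fun _ => x i₀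
  have hev : MvPolynomial.aeval ![X, C (x i₀)] A =
      (MvPolynomial.finSuccEquiv K 1 A).map (θ : MvPolynomial (Fin 1) K →+* E) := by
    have h : (MvPolynomial.aeval ![X, C (x i₀)] : MvPolynomial (Fin 2) K →ₐ[K] E[X]) =
        (mapAlgHom θ).comp (MvPolynomial.finSuccEquiv K 1 : _ →ₐ[K] _) := by
      refine MvPolynomial.algHom_ext fun i => ?_
      fin_cases i
      · simp [MvPolynomial.finSuccEquiv_X_zero]
      · change _ = mapAlgHom θ (MvPolynomial.finSuccEquiv K 1 (MvPolynomial.X (Fin.succ 0)))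
        rw [MvPolynomial.finSuccEquiv_X_succ]
        simp [θ]
    rw [h]
    rfl
  have hne : (MvPolynomial.aeval ![X, C (x i₀)] A).degree ≠ 0 := by
    rw [hev, degree_map_eq_of_leadingCoeff_ne_zero _ (hu.map _).ne_zero]
    exact (natDegree_pos_iff_degree_pos.1 hd).ne'
  have hspl : (MvPolynomial.aeval ![X, C (x i₀)] A).Splits := by
    refine Splits.of_dvd (Splits.prod fun i _ => Splits.X_sub_C (x i))
      (monic_prod_X_sub_C x Finset.univ).ne_zero ⟨_, hprod.symm⟩
  obtain ⟨r, hr⟩ := hspl.exists_eval_eq_zero hne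
  have h := congrArg (eval r) hprod
  rw [eval_mul, hr, zero_mul, eval_prod, eq_comm, Finset.prod_eq_zero_iff] at h
  obtain ⟨s, -, hs⟩ := h
  simp only [eval_sub, eval_X, eval_C, sub_eq_zero] at hs
  refine ⟨s, ?_⟩
  rw [← eval_aeval_pair, ← hs, hr]


theorem perm_affine_of_factor {K E : Type*} [Field K] [Field E] [Algebra K E] {j : ℕ}
    [Fact j.Prime] {T : E} {F : K[X]} (hF : F.Monic) (hdeg : F.natDegree = j) {x : ZMod j → E}
    (hx : Function.Injective x) (hroot : ∀ i, aeval (x i) F = T)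
    (hshift : ∀ a, ∃ σ : E →ₐ[K] E, ∀ i, σ (x i) = x (i + a))
    {A B : MvPolynomial (Fin 2) K}
    (hAB : A * B * (MvPolynomial.X 0 - MvPolynomial.X 1) =
      aeval (MvPolynomial.X 0) F - aeval (MvPolynomial.X 1) F)
    (hA : ¬ IsUnit A) (hB : ¬ IsUnit B) (π : Equiv.Perm (ZMod j))
    (hπ : ∀ Q : MvPolynomial (ZMod j) K,
        MvPolynomial.aeval x Q = 0 ↔ MvPolynomial.aeval (x ∘ π) Q = 0) :
    ∃ u v : ZMod j, ∀ i, π i = u * i + v := by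
  classical
  have hj : j.Prime := Fact.out
  have hpos : 0 < F.natDegree := hdeg ▸ hj.pos
  have hcard : Fintype.card (ZMod j) = F.natDegree := by rw [ZMod.card, hdeg]
  let S : MvPolynomial (Fin 2) K → Finset (ZMod j) := fun P =>
    Finset.univ.filter fun s => MvPolynomial.aeval ![x s, x 0] P = 0
  wlog hle : (S A).card ≤ (S B).card generalizing A B
  · exact this (mul_comm A B ▸ hAB) hB hA (le_of_not_ge hle)
  have h0 : ∀ s ∈ S A, s ≠ 0 ∧ MvPolynomial.aeval ![x s, x 0] B ≠ 0 := fun s hs =>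
    ne_of_aeval_pair_eq_zero hF hpos hx hroot hcard hAB (Finset.mem_filter.1 hs).2
  have h0' : ∀ s ∈ S B, s ≠ 0 := fun s hs =>
    (ne_of_aeval_pair_eq_zero hF hpos hx hroot hcard (mul_comm A B ▸ hAB)
      (Finset.mem_filter.1 hs).2).1
  have hdisj : Disjoint (S A) (S B) := by
    rw [Finset.disjoint_left]
    intro s hs hs'
    exact (h0 s hs).2 (Finset.mem_filter.1 hs').2
  have hsub : S A ∪ S B ⊆ Finset.univ.erase 0 := by
    intro s hs
    rw [Finset.mem_erase]
    rcases Finset.mem_union.1 hs with h | h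
    · exact ⟨(h0 s h).1, Finset.mem_univ _⟩
    · exact ⟨h0' s h, Finset.mem_univ _⟩
  have hc := Finset.card_le_card hsub
  rw [Finset.card_union_of_disjoint hdisj, Finset.card_erase_of_mem (Finset.mem_univ _),
    Finset.card_univ, ZMod.card] at hc
  have hrel : ∀ a b, MvPolynomial.aeval ![x b, x a] A = 0 ↔ b - a ∈ S A := by
    intro a b
    obtain ⟨σ, hσ⟩ := hshift a
    have h : MvPolynomial.aeval ![x b, x a] A = σ (MvPolynomial.aeval ![x (b - a), x 0] A) := by
      rw [MvPolynomial.comp_aeval_apply]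
      congr 2
      funext i
      fin_cases i <;> simp [hσ]
    rw [h, map_eq_zero]
    simp [S]
  obtain ⟨s, hs⟩ := exists_aeval_pair_eq_zero hF hpos hx hroot hcard hAB 0 hA
  refine perm_affine (S A) (fun h => (h0 0 h).1 rfl) ⟨s, by simp [S, hs]⟩ (by omega) π ?_
  intro a b hab
  rw [← hrel] at hab ⊢
  have h := hπ (MvPolynomial.rename ![b, a] A)
  simp only [MvPolynomial.aeval_rename] at h
  have e1 : x ∘ ![b, a] = ![x b, x a] := by
    funext i; fin_cases i <;> rfl
  have e2 : (x ∘ π) ∘ ![b, a] = ![x (π b), x (π a)] := by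
    funext i; fin_cases i <;> rfl
  rw [e1, e2] at h
  exact h.1 hab

theorem exists_prod_resolvent_pow_eq {K E : Type*} [Field K] [Field E] [Algebra K E] {j : ℕ}
    [Fact j.Prime] {T : E} (hT : Transcendental K T) {F : K[X]} (hF : F.Monic)
    (hdeg : F.natDegree = j) {x : ZMod j → E}
    (hx : Function.Injective x) (hroot : ∀ i, aeval (x i) F = T)
    (haff : ∀ π : Equiv.Perm (ZMod j), (∀ Q : MvPolynomial (ZMod j) K,
        MvPolynomial.aeval x Q = 0 ↔ MvPolynomial.aeval (x ∘ π) Q = 0) →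
      ∃ u v : ZMod j, ∀ i, π i = u * i + v)
    (e : AddChar (ZMod j) K) (Λ : Finset (ZMod j))
    (hΛ : ∀ k, k ∈ Λ ↔ ∑ i, algebraMap K E (e (-(i * k))) * x i ≠ 0) :
    ∃ q : K[X], (∏ k ∈ Λ, ∑ i, algebraMap K E (e (-(i * k))) * x i) ^ j = aeval T q := by
  have hj : j.Prime := Fact.out
  let R : ZMod j → MvPolynomial (ZMod j) K := fun k =>
    ∑ i, e (-(i * k)) • MvPolynomial.X i
  have hR : ∀ (y : ZMod j → E) k, MvPolynomial.aeval y (R k) =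
      ∑ i, algebraMap K E (e (-(i * k))) * y i := by
    intro y k
    simp [R, Algebra.smul_def]
  obtain ⟨q, hq⟩ := exists_aeval_eq_of_perm_invariant hT hF (hdeg ▸ hj.pos) hx hroot
    (by rw [ZMod.card, hdeg]) ((∏ k ∈ Λ, R k) ^ j) (by
      intro π hπ
      obtain ⟨u, v, huv⟩ := haff π hπ
      have hu : u ≠ 0 := by
        rintro rfl
        exact zero_ne_one (π.injective (by rw [huv, huv]; ring))
      have hpow : ∀ a, e a ^ j = 1 := by
        intro a
        rw [← AddChar.map_nsmul_eq_pow]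
        simp
      have key : ∀ k, MvPolynomial.aeval (x ∘ π) (R k) =
          e (v * (k * u⁻¹)) • MvPolynomial.aeval x (R (k * u⁻¹)) := by
        intro k
        rw [hR, hR, Finset.smul_sum]
        refine Fintype.sum_equiv π _ _ fun i => ?_
        rw [Algebra.smul_def, ← mul_assoc, ← map_mul, ← AddChar.map_add_eq_mul, huv]
        simp only [Function.comp, huv]
        congr 3
        field_simp
        ring
      have hmem : ∀ k, k ∈ Λ ↔ k * u⁻¹ ∈ Λ := by
        intro k
        rw [hΛ, hΛ, ← hR, ← hR, not_iff_not, hπ, key, smul_eq_zero]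
        have : e (v * (k * u⁻¹)) ≠ 0 := fun h0 => by
          simpa [h0, hj.ne_zero] using hpow (v * (k * u⁻¹))
        simp [this]
      rw [map_pow, map_pow, map_prod, map_prod, ← Finset.prod_pow, ← Finset.prod_pow]
      refine Finset.prod_equiv (Equiv.mulRight₀ u⁻¹ (inv_ne_zero hu)) (fun k => hmem k) ?_
      intro k _
      rw [key, _root_.smul_pow, hpow, one_smul]
      rfl)
  refine ⟨q, ?_⟩
  rw [← hq, map_pow, map_prod]
  simp_rw [hR]

theorem laurent_algebraMap {K : Type*} [Field K] (c : K) :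
    algebraMap K (LaurentSeries K) c = HahnSeries.ofPowerSeries ℤ K (PowerSeries.C c) := by
  rfl
theorem laurent_algebraMap' {K : Type*} [Field K] (c : K) :
    algebraMap K (LaurentSeries K) c = HahnSeries.single 0 c := by
  rw [laurent_algebraMap]; simp
theorem laurent_smul {K : Type*} [Field K] (c : K) (f : PowerSeries K):
    algebraMap K (LaurentSeries K) c * HahnSeries.ofPowerSeries ℤ K f = HahnSeries.ofPowerSeries ℤ K (c • f) := by
  rw [laurent_algebraMap, ← map_mul, PowerSeries.smul_eq_C_mul]

theorem coeff_aeval_single {K : Type*} [Field K] {j : ℕ} (hj : 0 < j) (q : K[X]) (N : ℕ) :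
    (aeval (HahnSeries.single (-(j : ℤ)) (1 : K) : LaurentSeries K) q).coeff (-(j : ℤ) * N) =
      q.coeff N := by
  have h : ∀ i : ℕ, (algebraMap K (LaurentSeries K) (q.coeff i) *
      (HahnSeries.single (-(j : ℤ)) (1 : K) : LaurentSeries K) ^ i) = HahnSeries.single (-(j : ℤ) * i) (q.coeff i) := by
    intro i
    rw [HahnSeries.single_pow, laurent_algebraMap', HahnSeries.single_mul_single]
    simp [mul_comm]
  rw [aeval_def, eval₂_eq_sum_range, HahnSeries.coeff_sum]
  have h2 : ∀ i : ℕ, (HahnSeries.single (-(j : ℤ) * i) (q.coeff i) : HahnSeries ℤ K).coeff (-(j : ℤ) * N) =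
      if i = N then q.coeff i else 0 := by
    intro i
    rw [HahnSeries.coeff_single]
    have : (-(j : ℤ) * N = -(j : ℤ) * i) ↔ i = N := by
      rw [mul_right_inj' (by omega), Nat.cast_inj, eq_comm]
    simp only [this]
  simp only [h, h2]
  rw [Finset.sum_ite_eq']
  split_ifs with hN
  · rfl
  · rw [coeff_eq_zero_of_natDegree_lt]
    simpa using hN

theorem transcendental_single {K : Type*} [Field K] {j : ℕ} (hj : 0 < j) :
    Transcendental K (HahnSeries.single (-(j : ℤ)) (1 : K) : LaurentSeries K) := by
  rw [transcendental_iff]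
  intro q hq
  ext N
  rw [← coeff_aeval_single hj, hq]
  simp

theorem aeval_single_eq_zero_of_eq {K : Type*} [Field K] {j : ℕ} (hj : 0 < j) (q : K[X])
    (f : PowerSeries K)
    (hq : aeval (HahnSeries.single (-(j : ℤ)) (1 : K) : LaurentSeries K) q =
      HahnSeries.ofPowerSeries ℤ K (PowerSeries.X * f)) : q = 0 := by
  ext N
  rw [← coeff_aeval_single hj, hq]
  rcases Nat.eq_zero_or_pos N with rfl | hN
  · have := HahnSeries.ofPowerSeries_apply_coeff (Γ := ℤ) (PowerSeries.X * f) 0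
    simpa using this
  · have : -(j : ℤ) * N < 0 := by
      have : (0 : ℤ) < j * N := by positivity
      linarith
    rw [PowerSeries.coeff_coe, if_pos this]
    simp

/-- The substitution `s ↦ c s` on Laurent series. -/
theorem exists_laurent_rescale {K : Type*} [Field K] {c : K} (hc : c ≠ 0) :
    ∃ σ : LaurentSeries K →ₐ[K] LaurentSeries K,
      (∀ f : PowerSeries K, σ (HahnSeries.ofPowerSeries ℤ K f) =
        HahnSeries.ofPowerSeries ℤ K (PowerSeries.rescale c f)) ∧
      ∀ a : K, σ (HahnSeries.single (-1) a) = HahnSeries.single (-1) (c⁻¹ * a) := by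
  let g : PowerSeries K →+* LaurentSeries K :=
    (HahnSeries.ofPowerSeries ℤ K).comp (PowerSeries.rescale c)
  have hg : Function.Injective g :=
    HahnSeries.ofPowerSeries_injective.comp (PowerSeries.rescale_injective hc)
  let σ₀ : LaurentSeries K →+* LaurentSeries K :=
    IsFractionRing.lift (A := PowerSeries K) (K := LaurentSeries K) hg
  have h1 : ∀ f : PowerSeries K, σ₀ (HahnSeries.ofPowerSeries ℤ K f) =
        HahnSeries.ofPowerSeries ℤ K (PowerSeries.rescale c f) := fun f =>
    IsFractionRing.lift_algebraMap hg f
  have hC : ∀ r : K, PowerSeries.rescale c (PowerSeries.C r) = PowerSeries.C r := by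
    intro r
    ext n
    rw [PowerSeries.coeff_rescale, PowerSeries.coeff_C]
    split_ifs with h <;> simp [h]
  refine ⟨{ σ₀ with commutes' := fun r => ?_ }, h1, fun a => ?_⟩
  · change σ₀ _ = _
    rw [laurent_algebraMap, h1, hC]
  · change σ₀ _ = _
    have hX : HahnSeries.ofPowerSeries ℤ K PowerSeries.X ≠ 0 := by
      simp
    have h2 : ∀ b : K, HahnSeries.single (-1) b * HahnSeries.ofPowerSeries ℤ K PowerSeries.X =
        HahnSeries.ofPowerSeries ℤ K (PowerSeries.C b) := fun b => by simp
    have h3 : HahnSeries.ofPowerSeries ℤ K (PowerSeries.rescale c PowerSeries.X) =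
        HahnSeries.ofPowerSeries ℤ K (PowerSeries.C c) * HahnSeries.ofPowerSeries ℤ K PowerSeries.X := by
      rw [← map_mul]
      congr 1
      ext n
      simp [PowerSeries.coeff_X]
    have h4 := congrArg σ₀ (h2 a)
    rw [map_mul, h1, h1, hC, h3, ← mul_assoc] at h4
    apply mul_right_cancel₀ hX
    rw [h2, map_mul (PowerSeries.C (R := K)), map_mul (HahnSeries.ofPowerSeries ℤ K), ← h4]
    rw [mul_comm _ (HahnSeries.ofPowerSeries ℤ K (PowerSeries.C c)), ← mul_assoc, ← mul_assoc, ← map_mul,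
      ← map_mul, inv_mul_cancel₀ hc, map_one, map_one, one_mul]

theorem resolvent_eq {K : Type*} [Field K] {j : ℕ} [Fact j.Prime] {e : AddChar (ZMod j) K}
    (he : e.IsPrimitive) (w : PowerSeries K) (k : ZMod j) :
    ∑ i, algebraMap K (LaurentSeries K) (e (-(i * k))) * ((HahnSeries.single (-1) (e i) *
        HahnSeries.ofPowerSeries ℤ K (PowerSeries.rescale (e (-i)) w) : LaurentSeries K)) =
      (HahnSeries.single (-1) 1 : LaurentSeries K) * HahnSeries.ofPowerSeries ℤ K
        (PowerSeries.mk fun n => if 1 - k - n = 0 then (j : K) * PowerSeries.coeff n w else 0) := by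
  have h : ∀ i, algebraMap K (LaurentSeries K) (e (-(i * k))) * ((HahnSeries.single (-1) (e i) *
        HahnSeries.ofPowerSeries ℤ K (PowerSeries.rescale (e (-i)) w) : LaurentSeries K)) =
      (HahnSeries.single (-1) 1 : LaurentSeries K) * HahnSeries.ofPowerSeries ℤ K
        ((e (-(i * k)) * e i) • PowerSeries.rescale (e (-i)) w) := by
    intro i
    rw [← laurent_smul, ← mul_assoc, ← mul_assoc]
    congr 1
    rw [laurent_algebraMap', laurent_algebraMap', HahnSeries.single_mul_single,
      HahnSeries.single_mul_single]
    simp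
  simp only [h]
  rw [← Finset.mul_sum, ← map_sum]
  congr 2
  ext n
  rw [map_sum, PowerSeries.coeff_mk]
  have h2 : ∀ i, PowerSeries.coeff n ((e (-(i * k)) * e i) • PowerSeries.rescale (e (-i)) w) =
      e (i * (1 - k - n)) * PowerSeries.coeff n w := by
    intro i
    rw [PowerSeries.coeff_smul, PowerSeries.coeff_rescale, smul_eq_mul, ← mul_assoc,
      ← AddChar.map_nsmul_eq_pow, ← AddChar.map_add_eq_mul, ← AddChar.map_add_eq_mul]
    congr 2
    simp
    ring
  rw [Finset.sum_congr rfl fun i _ => h2 i, ← Finset.sum_mul, AddChar.sum_mulShift _ he, ZMod.card]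
  split_ifs <;> simp


/-- Hensel's lemma for `∏ (w + i s) = 1`. -/
theorem exists_powerSeries_prod_eq_one {K : Type*} [Field K] {j : ℕ} (hj : (j : K) ≠ 0) :
    ∃ w : PowerSeries K, PowerSeries.constantCoeff w = 1 ∧
      ∏ i ∈ Finset.Icc 1 j, (w + PowerSeries.C (i : K) * PowerSeries.X) = 1 := by
  let P : (PowerSeries K)[X] := ∏ i ∈ Finset.Icc 1 j, (X + C (PowerSeries.C (i : K) * PowerSeries.X))
  have hj0 : 0 < j := Nat.pos_of_ne_zero fun h => hj (by simp [h])
  have hP : P.Monic := monic_prod_of_monic _ _ fun i _ => monic_X_add_C _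
  have hPd : P.natDegree = j := by
    rw [natDegree_prod_of_monic _ _ fun i _ => monic_X_add_C _]
    simp only [natDegree_X_add_C]
    simp
  have hmap : P.map (PowerSeries.constantCoeff (R := K)) = X ^ j := by
    simp [P, Polynomial.map_prod]
  have hf : (P - 1).Monic := by
    refine hP.sub_of_left ?_
    rw [degree_one, degree_eq_natDegree hP.ne_zero, hPd]
    exact_mod_cast hj0
  have hmem : ∀ f : PowerSeries K, f ∈ Ideal.span {PowerSeries.X} ↔
      PowerSeries.constantCoeff f = 0 := fun f => by
    rw [Ideal.mem_span_singleton, PowerSeries.X_dvd_iff]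
  have hev : ∀ (Q : (PowerSeries K)[X]) (a : PowerSeries K), PowerSeries.constantCoeff (Q.eval a) =
      (Q.map (PowerSeries.constantCoeff (R := K))).eval (PowerSeries.constantCoeff a) := by
    intro Q a
    rw [eval_map, eval₂_at_apply]
  obtain ⟨w, hw, hw1⟩ := HenselianRing.is_henselian (R := PowerSeries K)
    (I := Ideal.span {PowerSeries.X}) (P - 1) hf 1 (by
      rw [hmem, hev, Polynomial.map_sub, hmap]
      simp) (by
      apply IsUnit.map
      rw [PowerSeries.isUnit_iff_constantCoeff, hev, ← derivative_map, Polynomial.map_sub, hmap]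
      simpa [derivative_X_pow] using hj)
  refine ⟨w, ?_, ?_⟩
  · rw [hmem, map_sub, sub_eq_zero] at hw1
    simpa using hw1
  · have := hw
    rw [IsRoot, eval_sub, eval_one, sub_eq_zero] at this
    simpa [P, eval_prod] using this


/-- The conjugates of the root of `F = s⁻ʲ`. -/
noncomputable def conjugate {K : Type*} [Field K] {j : ℕ} (e : AddChar (ZMod j) K)
    (w : PowerSeries K) (i : ZMod j) : LaurentSeries K :=
  HahnSeries.single (-1) (e i) * HahnSeries.ofPowerSeries ℤ K (PowerSeries.rescale (e (-i)) w)

theorem conjugate_coeff {K : Type*} [Field K] {j : ℕ} (e : AddChar (ZMod j) K)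
    (w : PowerSeries K) (i : ZMod j) (hw : PowerSeries.constantCoeff w = 1) :
    (conjugate e w i).coeff (-1) = e i := by
  have h := HahnSeries.coeff_single_mul_add (r := e i)
    (x := HahnSeries.ofPowerSeries ℤ K (PowerSeries.rescale (e (-i)) w)) (a := 0) (b := -1)
  rw [zero_add] at h
  rw [conjugate, h]
  have := HahnSeries.ofPowerSeries_apply_coeff (Γ := ℤ) (PowerSeries.rescale (e (-i)) w) 0
  rw [Nat.cast_zero] at this
  rw [this]
  simp [PowerSeries.coeff_rescale, hw]

theorem aeval_conjugate {K : Type*} [Field K] {j : ℕ} (e : AddChar (ZMod j) K)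
    (w : PowerSeries K)
    (hw : ∏ i ∈ Finset.Icc 1 j, (w + PowerSeries.C (i : K) * PowerSeries.X) = 1) (i : ZMod j) :
    aeval (conjugate e w i) (∏ i ∈ Finset.Icc 1 j, (X + C (i : K)) : K[X]) =
      HahnSeries.single (-(j : ℤ)) 1 := by
  have he : e i * e (-i) = 1 := by
    rw [← AddChar.map_add_eq_mul]; simp
  have h : ∀ n : ℕ, aeval (conjugate e w i) (X + C (n : K) : K[X]) = HahnSeries.single (-1) (e i) *
      HahnSeries.ofPowerSeries ℤ K (PowerSeries.rescale (e (-i))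
        (w + PowerSeries.C (n : K) * PowerSeries.X)) := by
    intro n
    have h1 : PowerSeries.rescale (e (-i)) (PowerSeries.C (n : K) * PowerSeries.X) =
        PowerSeries.C (e (-i) * n) * PowerSeries.X := by
      ext m
      rw [PowerSeries.coeff_rescale, PowerSeries.coeff_C_mul, PowerSeries.coeff_C_mul,
        PowerSeries.coeff_X]
      split_ifs with h
      · rw [h, pow_one, mul_one, mul_one]
      · simp
    have h2 : (HahnSeries.single (-1) (e i) : LaurentSeries K) *
        HahnSeries.ofPowerSeries ℤ K (PowerSeries.C (e (-i) * n) * PowerSeries.X) =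
        algebraMap K (LaurentSeries K) n := by
      rw [laurent_algebraMap', map_mul, HahnSeries.ofPowerSeries_X, HahnSeries.ofPowerSeries_C,
        HahnSeries.C_apply, HahnSeries.single_mul_single, HahnSeries.single_mul_single]
      simp [← mul_assoc, he]
    rw [map_add, aeval_X, aeval_C, ← h2, map_add, map_add, mul_add, h1]
    rfl
  rw [map_prod, Finset.prod_congr rfl fun n _ => h n, Finset.prod_mul_distrib,
    ← map_prod (HahnSeries.ofPowerSeries ℤ K), ← map_prod (PowerSeries.rescale _), hw, map_one, map_one, mul_one, Finset.prod_const, HahnSeries.single_pow,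
    ← AddChar.map_nsmul_eq_pow]
  simp

theorem exists_conjugate_shift {K : Type*} [Field K] {j : ℕ} (e : AddChar (ZMod j) K)
    (w : PowerSeries K) (a : ZMod j) :
    ∃ σ : LaurentSeries K →ₐ[K] LaurentSeries K, ∀ i, σ (conjugate e w i) =
      conjugate e w (i + a) := by
  have he : e a * e (-a) = 1 := by
    rw [← AddChar.map_add_eq_mul]; simp
  obtain ⟨σ, h1, h2⟩ := exists_laurent_rescale (right_ne_zero_of_mul_eq_one he)
  refine ⟨σ, fun i => ?_⟩
  rw [conjugate, map_mul, h1, h2, conjugate, PowerSeries.rescale_rescale, inv_eq_of_mul_eq_one_left he,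
    ← AddChar.map_add_eq_mul, ← AddChar.map_add_eq_mul, add_comm a i, neg_add]

theorem conjugate_injective {K : Type*} [Field K] {j : ℕ} [Fact j.Prime] {e : AddChar (ZMod j) K}
    (he : e.IsPrimitive)
    {w : PowerSeries K} (hw : PowerSeries.constantCoeff w = 1) :
    Function.Injective (conjugate e w) := by
  intro a b hab
  have h : e a = e b := by rw [← conjugate_coeff e w a hw, hab, conjugate_coeff e w b hw]
  have h1 : e (a - b) * e b = 1 * e b := by
    rw [← AddChar.map_add_eq_mul, sub_add_cancel, h, one_mul]
  have h2 := mul_right_cancel₀ (AddChar.val_isUnit e b).ne_zero h1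
  exact sub_eq_zero.1 ((he.zmod_char_eq_one_iff j _).1 h2)


theorem prod_add_mul_sub_eq {R : Type*} [CommRing R] (W s : R) (h : ℕ) :
    ∏ i ∈ Finset.range (2 * h + 1), (W + ((i : R) - h) * s) =
      W * ∏ i ∈ Finset.range h, (W ^ 2 - ((i : R) + 1) ^ 2 * s ^ 2) := by
  induction h with
  | zero => simp
  | succ h ih =>
    rw [show 2 * (h + 1) + 1 = 2 * h + 1 + 1 + 1 by ring, Finset.prod_range_succ _ (2 * h + 1 + 1),
      Finset.prod_range_succ' _ (2 * h + 1), Finset.prod_range_succ _ h, ← mul_assoc, ← ih]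
    have : ∀ i ∈ Finset.range (2 * h + 1), W + (((i + 1 : ℕ) : R) - (h + 1 : ℕ)) * s =
        W + ((i : R) - h) * s := by
      intro i _
      push_cast
      ring
    rw [Finset.prod_congr rfl this]
    push_cast
    ring

theorem exists_prod_sub_eq {K R : Type*} [Field K] [CommRing R] [Algebra K R] (W s : R) (h : ℕ) :
    ∃ E₁ E₂ : K, 6 * E₁ = h * (h + 1) * (2 * h + 1) ∧
      360 * E₂ = 5 * (h * (h + 1) * (2 * h + 1)) ^ 2 -
        6 * (h * (h + 1) * (2 * h + 1)) * (3 * h ^ 2 + 3 * h - 1) ∧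
      ∃ r, W ^ 4 * ∏ i ∈ Finset.range h, (W ^ 2 - ((i : R) + 1) ^ 2 * s ^ 2) =
        W ^ (2 * h + 4) - algebraMap K R E₁ * s ^ 2 * W ^ (2 * h + 2) +
          algebraMap K R E₂ * s ^ 4 * W ^ (2 * h) + s ^ 6 * r := by
  induction h with
  | zero => exact ⟨0, 0, by simp, by simp, 0, by simp⟩
  | succ h ih =>
    obtain ⟨E₁, E₂, h₁, h₂, r, hr⟩ := ih
    refine ⟨E₁ + (h + 1) ^ 2, E₂ + (h + 1) ^ 2 * E₁, ?_, ?_,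
      r * (W ^ 2 - ((h : R) + 1) ^ 2 * s ^ 2) -
        ((h : R) + 1) ^ 2 * algebraMap K R E₂ * W ^ (2 * h), ?_⟩
    · push_cast
      linear_combination h₁
    · push_cast
      linear_combination h₂ + 60 * ((h : K) + 1) ^ 2 * h₁
    · rw [Finset.prod_range_succ, ← mul_assoc, hr]
      simp only [map_add, map_mul, map_pow, map_natCast, map_one]
      ring

theorem exists_two_mul_one_add_pow_eq {R : Type*} [CommRing R] (x : R) (m : ℕ) :
    ∃ r, 2 * (1 + x) ^ m = 2 + 2 * m * x + m * (m - 1) * x ^ 2 + x ^ 3 * r := by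
  induction m with
  | zero => exact ⟨0, by simp⟩
  | succ m ih =>
    obtain ⟨r, hr⟩ := ih
    refine ⟨m * (m - 1) + (1 + x) * r, ?_⟩
    rw [pow_succ, ← mul_assoc, hr]
    push_cast
    ring

theorem coeff_four_ne_zero {K : Type*} [Field K] {h : ℕ} (h2 : (2 : K) ≠ 0) (h3 : (3 : K) ≠ 0)
    (hj : (2 * h + 1 : K) ≠ 0) (hh : (h * (h + 1) * (h + 2) * (h - 1) : K) ≠ 0)
    {w : PowerSeries K} (hw0 : PowerSeries.constantCoeff w = 1)
    (hw : ∏ i ∈ Finset.Icc 1 (2 * h + 1), (w + PowerSeries.C (i : K) * PowerSeries.X) = 1) :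
    PowerSeries.coeff 4 w ≠ 0 := by
  set s : PowerSeries K := PowerSeries.X with hs
  set W := w + PowerSeries.C (h + 1 : K) * s with hW
  have hprod : W * ∏ i ∈ Finset.range h, (W ^ 2 - ((i : PowerSeries K) + 1) ^ 2 * s ^ 2) = 1 := by
    rw [← prod_add_mul_sub_eq, ← hw, Finset.prod_bij (fun i _ => i + 1)]
    · intro i hi
      simp only [Finset.mem_range, Finset.mem_Icc] at hi ⊢
      omega
    · intro a _ b _ hab
      omega
    · intro b hb
      rw [Finset.mem_Icc] at hb
      exact ⟨b - 1, Finset.mem_range.2 (by omega), by omega⟩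
    · intro i _
      simp only [hW, map_add, map_natCast, map_one]
      push_cast
      ring
  obtain ⟨E₁, E₂, h₁, h₂, r, hr⟩ := exists_prod_sub_eq (K := K) W s h
  rw [pow_succ, mul_assoc, hprod, mul_one] at hr
  obtain ⟨u, hu⟩ : s ∣ W - 1 := by
    rw [hs, PowerSeries.X_dvd_iff, hW]
    simp [hw0, hs]
  have hWu : W = 1 + s * u := by linear_combination hu
  have hE : ∀ E : K, algebraMap K (PowerSeries K) E = PowerSeries.C E := fun _ => rfl
  simp only [hE] at hr
  obtain ⟨r₁, hr₁⟩ := exists_two_mul_one_add_pow_eq (s * u) (2 * h + 4)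
  obtain ⟨r₂, hr₂⟩ := exists_two_mul_one_add_pow_eq (s * u) (2 * h + 2)
  obtain ⟨r₃, hr₃⟩ := exists_two_mul_one_add_pow_eq (s * u) (2 * h)
  push_cast at hr₁ hr₂ hr₃
  rw [← hWu] at hr₁ hr₂ hr₃
  have hW3 : W ^ 3 = 1 + 3 * (s * u) + 3 * (s * u) ^ 2 + (s * u) ^ 3 := by
    rw [hWu]
    ring
  have hc2 : PowerSeries.constantCoeff (2 : PowerSeries K) = 2 := map_ofNat _ 2
  have hc3 : PowerSeries.constantCoeff (3 : PowerSeries K) = 3 := map_ofNat _ 3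
  have hc4 : PowerSeries.constantCoeff (4 : PowerSeries K) = 4 := map_ofNat _ 4
  have hc6 : PowerSeries.constantCoeff (6 : PowerSeries K) = 6 := map_ofNat _ 6
  have hC2 : PowerSeries.C (2 : K) = 2 := map_ofNat _ 2
  obtain ⟨v, hv⟩ : s ∣ u := by
    rw [hs, PowerSeries.X_dvd_iff]
    have key : s * ((2 * (2 * h + 1)) * u + s * ((2 * h + 4) * (2 * h + 3) * u ^ 2 +
        s * u ^ 3 * r₁ - 2 * PowerSeries.C E₁ * W ^ (2 * h + 2) +
        2 * PowerSeries.C E₂ * s ^ 2 * W ^ (2 * h) + 2 * s ^ 4 * r - 6 * u ^ 2 -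
        2 * s * u ^ 3)) = 0 := by
      linear_combination 2 * hW3 - 2 * hr - hr₁
    rw [mul_eq_zero, or_iff_right PowerSeries.X_ne_zero] at key
    have := congrArg PowerSeries.constantCoeff key
    simpa [hs, hc2, h2, hj] using this
  have key : s ^ 2 * ((2 * (2 * h + 1)) * v - 2 * PowerSeries.C E₁ + s ^ 2 * (
      (2 * h + 4) * (2 * h + 3) * v ^ 2 - 6 * v ^ 2 - 2 * PowerSeries.C E₁ * (2 * h + 2) * v +
        2 * PowerSeries.C E₂) + s ^ 4 * (v ^ 3 * r₁ - 2 * v ^ 3 -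
      PowerSeries.C E₁ * ((2 * h + 2) * (2 * h + 1) * v ^ 2 + s ^ 2 * v ^ 3 * r₂) +
      PowerSeries.C E₂ * (2 * (2 * h) * v + 2 * h * (2 * h - 1) * s ^ 2 * v ^ 2 +
        s ^ 4 * v ^ 3 * r₃) + 2 * r)) = 0 := by
    rw [hv] at hW3 hr₁ hr₂ hr₃
    linear_combination 2 * hW3 - 2 * hr - hr₁ + PowerSeries.C E₁ * s ^ 2 * hr₂ -
      PowerSeries.C E₂ * s ^ 4 * hr₃
  rw [mul_eq_zero, or_iff_right (pow_ne_zero 2 PowerSeries.X_ne_zero)] at key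
  set v₀ := PowerSeries.constantCoeff v with hv₀
  have key₀ : 2 * (2 * h + 1) * v₀ - 2 * E₁ = 0 := by
    simpa [hs, hc2] using congrArg PowerSeries.constantCoeff key
  have hcoeff : ∀ (f : PowerSeries K), PowerSeries.coeff 2 (s ^ 2 * f) =
      PowerSeries.constantCoeff f := fun f => by
    simpa using PowerSeries.coeff_X_pow_mul f 2 0
  have key₂ : 2 * (2 * h + 1) * PowerSeries.coeff 2 v +
      ((2 * h + 4) * (2 * h + 3) * v₀ ^ 2 - 6 * v₀ ^ 2 - 2 * E₁ * (2 * h + 2) * v₀ + 2 * E₂) = 0 := by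
    have hsplit : (2 * (2 * h + 1) : PowerSeries K) * v = PowerSeries.C (2 * (2 * h + 1) : K) * v := by
      simp [hC2]
    have hsplit' : (2 : PowerSeries K) * PowerSeries.C E₁ = PowerSeries.C (2 * E₁) := by simp [hC2]
    rw [show s ^ 4 = s ^ 2 * s ^ 2 by ring, mul_assoc (s ^ 2) (s ^ 2), add_assoc, ← mul_add, hsplit, hsplit'] at key
    have := congrArg (PowerSeries.coeff 2) key
    rw [map_add, hcoeff, map_sub, PowerSeries.coeff_C_mul] at this
    simpa [hs, PowerSeries.coeff_C, hc2, hc3, hc4, hc6] using this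
  have hw4 : PowerSeries.coeff 4 w = PowerSeries.coeff 2 v := by
    have hw' : w = PowerSeries.C 1 + s ^ 2 * v - PowerSeries.C (h + 1 : K) * s := by
      rw [map_one]
      linear_combination hWu - hW + s * hv
    rw [hw', map_sub, map_add, PowerSeries.coeff_C, PowerSeries.coeff_C_mul]
    simpa [hs, PowerSeries.coeff_X] using PowerSeries.coeff_X_pow_mul v 2 2
  rw [hw4]
  intro h0
  rw [h0] at key₂
  have hfin : 2 * 3 * (2 * h + 1 : K) ^ 3 * (h * (h + 1) * (h + 2) * (h - 1)) = 0 := by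
    linear_combination -360 * (2 * h + 1 : K) ^ 2 * key₂ + 180 * ((4 * h ^ 2 + 14 * h + 6) *
      ((2 * h + 1) * v₀ + E₁) - 2 * E₁ * (2 * h + 2) * (2 * h + 1)) * key₀ -
      10 * (2 * h + 1) * (2 * h - 2) * (6 * E₁ + h * (h + 1) * (2 * h + 1)) * h₁ +
      2 * (2 * h + 1 : K) ^ 2 * h₂
  simp [h2, h3, hj] at hfin
  simp at hh
  tauto


theorem single_neg_one_mul_ofPowerSeries_X_mul {K : Type*} [Field K] (f : PowerSeries K) :
    (HahnSeries.single (-1) 1 : LaurentSeries K) *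
      HahnSeries.ofPowerSeries ℤ K (PowerSeries.X * f) = HahnSeries.ofPowerSeries ℤ K f := by
  rw [map_mul, ← mul_assoc, HahnSeries.ofPowerSeries_X, HahnSeries.single_mul_single]
  simp

theorem isUnit_or_isUnit_of_five_le {K : Type*} [Field K] [IsAlgClosed K] {j h : ℕ} [Fact j.Prime]
    (hjh : j = 2 * h + 1) (hh : 2 ≤ h) (hK : ∀ n : ℕ, 0 < n → n ≤ j → (n : K) ≠ 0)
    {A B : MvPolynomial (Fin 2) K}
    (hAB : A * B * (MvPolynomial.X 0 - MvPolynomial.X 1) =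
      aeval (MvPolynomial.X 0) (∏ i ∈ Finset.Icc 1 j, (X + C (i : K)) : K[X]) -
        aeval (MvPolynomial.X 1) (∏ i ∈ Finset.Icc 1 j, (X + C (i : K)) : K[X])) :
    IsUnit A ∨ IsUnit B := by
  classical
  by_contra! hu
  have hj : j.Prime := Fact.out
  have hjK : (j : K) ≠ 0 := hK j hj.pos le_rfl
  have : NeZero (j : K) := ⟨hjK⟩
  obtain ⟨ζ, hζ⟩ := HasEnoughRootsOfUnity.exists_primitiveRoot K j
  have he := AddChar.zmodChar_primitive_of_primitive_root j hζ
  set e := AddChar.zmodChar j ((IsPrimitiveRoot.iff_def ζ j).mp hζ).1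
  obtain ⟨w, hw0, hw⟩ := exists_powerSeries_prod_eq_one hjK
  have hw4 : PowerSeries.coeff 4 w ≠ 0 := by
    have h2 := hK 2 (by omega) (by omega)
    have h3 := hK 3 (by omega) (by omega)
    have h5 := hK h (by omega) (by omega)
    have h6 := hK (h + 1) (by omega) (by omega)
    have h7 := hK (h + 2) (by omega) (by omega)
    have h8 := hK (h - 1) (by omega) (by omega)
    rw [Nat.cast_sub (by omega)] at h8
    push_cast at h2 h3 h6 h7 h8
    subst hjh
    exact coeff_four_ne_zero h2 h3 (by exact_mod_cast hjK)
      (mul_ne_zero (mul_ne_zero (mul_ne_zero h5 h6) h7) h8) hw0 hw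
  set F : K[X] := ∏ i ∈ Finset.Icc 1 j, (X + C (i : K)) with hFdef
  have hF : F.Monic := monic_prod_of_monic _ _ fun i _ => monic_X_add_C _
  have hFd : F.natDegree = j := by
    rw [hFdef, natDegree_prod_of_monic _ _ fun i _ => monic_X_add_C _]
    simp only [natDegree_X_add_C]
    simp
  have hx := conjugate_injective he hw0
  have hroot := aeval_conjugate e w hw
  let ρ : ZMod j → PowerSeries K := fun k =>
    PowerSeries.mk fun n => if 1 - k - n = 0 then (j : K) * PowerSeries.coeff n w else 0
  have hR : ∀ k, ∑ i, algebraMap K (LaurentSeries K) (e (-(i * k))) * conjugate e w i =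
      HahnSeries.single (-1) 1 * HahnSeries.ofPowerSeries ℤ K (ρ k) := resolvent_eq he w
  obtain ⟨q, hq⟩ := exists_prod_resolvent_pow_eq (transcendental_single hj.pos) hF hFd hx hroot
    (perm_affine_of_factor hF hFd hx hroot (exists_conjugate_shift e w) hAB hu.1 hu.2) e
    (Finset.univ.filter fun k =>
      ∑ i, algebraMap K (LaurentSeries K) (e (-(i * k))) * conjugate e w i ≠ 0)
    (fun k => by simp)
  set Λ := Finset.univ.filter fun k =>
      ∑ i, algebraMap K (LaurentSeries K) (e (-(i * k))) * conjugate e w i ≠ 0 with hΛ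
  have hmem : ∀ (k : ZMod j) (n : ℕ), 1 - k - n = 0 → PowerSeries.coeff n w ≠ 0 → k ∈ Λ := by
    intro k n hk hn
    rw [hΛ, Finset.mem_filter, hR]
    refine ⟨Finset.mem_univ _, mul_ne_zero (by simp) ?_⟩
    rw [Ne, map_eq_zero_iff _ HahnSeries.ofPowerSeries_injective]
    intro h0
    have := congrArg (PowerSeries.coeff n) h0
    simp only [ρ, PowerSeries.coeff_mk, map_zero] at this
    rw [if_pos hk] at this
    exact mul_ne_zero hjK hn this
  have h1 : (1 : ZMod j) ∈ Λ := hmem 1 0 (by simp) (by simp [hw0])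
  have h3 : (-3 : ZMod j) ∈ Λ := hmem (-3) 4 (by push_cast; ring) hw4
  have hne : ∀ n : ℕ, 0 < n → n < j → (n : ZMod j) ≠ 0 := fun n hn hnj => by
    rw [Ne, ZMod.natCast_eq_zero_iff]
    exact Nat.not_dvd_of_pos_of_lt hn hnj
  have h13 : (-3 : ZMod j) ≠ 1 := by
    intro h
    apply hne 4 (by omega) (by omega)
    push_cast
    linear_combination -h
  have hdvd : ∀ k, k ≠ 1 → PowerSeries.X ∣ ρ k := by
    intro k hk
    rw [PowerSeries.X_dvd_iff, ← PowerSeries.coeff_zero_eq_constantCoeff_apply,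
      PowerSeries.coeff_mk, if_neg]
    rw [Nat.cast_zero, sub_zero, sub_eq_zero]
    exact hk.symm
  have hdvd3 : PowerSeries.X ^ 4 ∣ ρ (-3) := by
    rw [PowerSeries.X_pow_dvd_iff]
    intro m hm
    rw [PowerSeries.coeff_mk, if_neg]
    have := hne (4 - m) (by omega) (by omega)
    rw [Nat.cast_sub hm.le] at this
    intro h0
    apply this
    push_cast
    linear_combination h0
  have hrest : ∀ S : Finset (ZMod j), 1 ∉ S → ∃ g, ∏ k ∈ S, (HahnSeries.single (-1) 1 *
      HahnSeries.ofPowerSeries ℤ K (ρ k) : LaurentSeries K) =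
      HahnSeries.ofPowerSeries ℤ K g := by
    intro S hS
    have : ∀ k : S, ∃ g, ρ k = PowerSeries.X * g := fun k =>
      hdvd k fun h => hS (h ▸ k.2)
    choose g hg using this
    refine ⟨∏ k : S, g k, ?_⟩
    rw [map_prod, ← Finset.prod_coe_sort]
    refine Finset.prod_congr rfl fun k _ => ?_
    rw [hg, single_neg_one_mul_ofPowerSeries_X_mul]
  have hprod : ∃ g, ∏ k ∈ Λ, (HahnSeries.single (-1) 1 *
      HahnSeries.ofPowerSeries ℤ K (ρ k) : LaurentSeries K) =
      HahnSeries.ofPowerSeries ℤ K (PowerSeries.X * g) := by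
    obtain ⟨g, hg⟩ := hrest ((Λ.erase 1).erase (-3)) (by simp)
    obtain ⟨g', hg'⟩ := hdvd3
    refine ⟨PowerSeries.X * ρ 1 * g' * g, ?_⟩
    rw [← Finset.mul_prod_erase _ _ h1, ← Finset.mul_prod_erase _ _ (Finset.mem_erase.2 ⟨h13, h3⟩),
      hg, hg', pow_succ', mul_assoc PowerSeries.X, single_neg_one_mul_ofPowerSeries_X_mul, ← map_mul,
      mul_assoc, ← map_mul,
      ← single_neg_one_mul_ofPowerSeries_X_mul (PowerSeries.X * (PowerSeries.X * ρ 1 * g' * g))]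
    congr 2
    ring
  have hne0 : (∏ k ∈ Λ, ∑ i, algebraMap K (LaurentSeries K) (e (-(i * k))) * conjugate e w i) ^ j ≠ 0 :=
    pow_ne_zero _ (Finset.prod_ne_zero_iff.2 fun k hk => (Finset.mem_filter.1 hk).2)
  apply hne0
  obtain ⟨g, hg⟩ := hprod
  have hq0 : q = 0 := by
    refine aeval_single_eq_zero_of_eq hj.pos q (g * (PowerSeries.X * g) ^ (j - 1)) ?_
    rw [← hq, ← mul_assoc, ← pow_succ', Nat.sub_add_cancel hj.pos, map_pow, ← hg]
    simp_rw [hR]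
  rw [hq, hq0, map_zero]

theorem coeff_eq_of_quadratic_eq {R : Type*} [CommRing R] {a b c a' b' c' : R}
    (h : C a * X ^ 2 + C b * X + C c = C a' * X ^ 2 + C b' * X + C c') :
    a = a' ∧ b = b' ∧ c = c' := by
  refine ⟨?_, ?_, ?_⟩
  · simpa [coeff_X, coeff_C] using congrArg (coeff · 2) h
  · simpa [coeff_X, coeff_C] using congrArg (coeff · 1) h
  · simpa [coeff_X, coeff_C] using congrArg (coeff · 0) h

theorem isUnit_or_isUnit_of_three {K : Type*} [Field K] (h2 : (2 : K) ≠ 0) (h3 : (3 : K) ≠ 0)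
    {A B : MvPolynomial (Fin 2) K}
    (hAB : A * B * (MvPolynomial.X 0 - MvPolynomial.X 1) =
      aeval (MvPolynomial.X 0) (∏ i ∈ Finset.Icc (1 : ℕ) 3, (X + C (i : K)) : K[X]) -
        aeval (MvPolynomial.X 1) (∏ i ∈ Finset.Icc (1 : ℕ) 3, (X + C (i : K)) : K[X])) :
    IsUnit A ∨ IsUnit B := by
  by_contra! hu
  set F : K[X] := ∏ i ∈ Finset.Icc (1 : ℕ) 3, (X + C (i : K)) with hFdef
  have hF : F.Monic := monic_prod_of_monic _ _ fun i _ => monic_X_add_C _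
  have hFd : 0 < F.natDegree := by
    rw [hFdef, natDegree_prod_of_monic _ _ fun i _ => monic_X_add_C _]
    simp only [natDegree_X_add_C]
    simp
  have hA := natDegree_pos_of_factor hF hFd (A := A) (B := B * (MvPolynomial.X 0 - MvPolynomial.X 1))
    (by rw [← hAB]; ring) hu.1
  have hB := natDegree_pos_of_factor hF hFd (A := B) (B := A * (MvPolynomial.X 0 - MvPolynomial.X 1))
    (by rw [← hAB]; ring) hu.2
  have hφ : A * B = MvPolynomial.X 0 ^ 2 + (MvPolynomial.X 1 + 6) * MvPolynomial.X 0 +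
      (MvPolynomial.X 1 ^ 2 + 6 * MvPolynomial.X 1 + 11) := by
    have hne : (MvPolynomial.X 0 - MvPolynomial.X 1 : MvPolynomial (Fin 2) K) ≠ 0 := by
      rw [sub_ne_zero]
      exact fun h => zero_ne_one (MvPolynomial.X_injective h)
    apply mul_right_cancel₀ hne
    have hF3 : F = (X + 1) * (X + 2) * (X + 3) := by
      rw [hFdef, show Finset.Icc (1 : ℕ) 3 = {1, 2, 3} from rfl]
      simp [mul_assoc]
    rw [hAB, hF3]
    simp only [map_mul, map_add, aeval_X, map_one, map_ofNat]
    ring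
  have hφ' := congrArg (MvPolynomial.finSuccEquiv K 1) hφ
  set y : MvPolynomial (Fin 1) K := MvPolynomial.X 0
  have hX1 : MvPolynomial.finSuccEquiv K 1 (MvPolynomial.X 1) = C y :=
    MvPolynomial.finSuccEquiv_X_succ (j := 0)
  simp only [map_mul, map_add, map_pow, map_ofNat, hX1, MvPolynomial.finSuccEquiv_X_zero] at hφ'
  set A' := MvPolynomial.finSuccEquiv K 1 A
  set B' := MvPolynomial.finSuccEquiv K 1 B
  have hφ2 : A' * B' = C 1 * X ^ 2 + C (y + 6) * X + C (y ^ 2 + 6 * y + 11) := by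
    rw [hφ']
    simp only [map_add, map_mul, map_pow, map_ofNat, map_one, one_mul]
  have hdeg : (A' * B').natDegree = 2 := by
    rw [hφ2]
    exact natDegree_quadratic one_ne_zero
  have hAB0 : A' * B' ≠ 0 := fun h => by simp [h] at hdeg
  rw [natDegree_mul (left_ne_zero_of_mul hAB0) (right_ne_zero_of_mul hAB0)] at hdeg
  have hA1 := eq_X_add_C_of_natDegree_le_one (p := A') (by omega)
  have hB1 := eq_X_add_C_of_natDegree_le_one (p := B') (by omega)
  generalize A'.coeff 1 = u, A'.coeff 0 = a at hA1
  generalize B'.coeff 1 = v, B'.coeff 0 = b at hB1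
  have hquad : C (u * v) * X ^ 2 + C (u * b + v * a) * X + C (a * b) =
      C 1 * X ^ 2 + C (y + 6) * X + C (y ^ 2 + 6 * y + 11) := by
    rw [← hφ2, hA1, hB1]
    simp only [map_mul, map_add]
    ring
  obtain ⟨e2, e1, e0⟩ := coeff_eq_of_quadratic_eq hquad
  have hD : (u * b - v * a) ^ 2 = -3 * y ^ 2 - 12 * y - 8 := by
    linear_combination (u * b + v * a + y + 6) * e1 - 4 * a * b * e2 - 4 * e0
  have hD' := congrArg (MvPolynomial.aeval fun _ => (X : K[X])) hD
  simp only [map_pow, map_sub, map_mul, map_neg, map_ofNat, y, MvPolynomial.aeval_X] at hD'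
  rw [← map_mul, ← map_mul, ← map_sub] at hD'
  set D : K[X] := MvPolynomial.aeval (fun _ => (X : K[X])) (u * b - v * a)
  have hq : D ^ 2 = C (-3) * X ^ 2 + C (-12) * X + C (-8) := by
    rw [hD']
    simp only [map_neg, map_ofNat]
    ring
  have hder : 2 * D * derivative D = -6 * X - 12 := by
    have := congrArg derivative hq
    rw [derivative_sq] at this
    simp only [derivative_add, derivative_C_mul, derivative_X_sq, derivative_X, derivative_C] at this
    simp only [map_neg, map_ofNat] at this
    linear_combination this
  have hdvd : D * ((2 * D) - (X + 2) * (2 * derivative D)) = C 8 := by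
    rw [map_ofNat]
    linear_combination 2 * hD' - (X + 2) * hder
  have h8 : (8 : K) ≠ 0 := by
    have := pow_ne_zero 3 h2
    norm_num at this
    exact this
  have hDu : IsUnit D := isUnit_of_mul_isUnit_left (hdvd ▸ isUnit_C.2 h8.isUnit)
  have := natDegree_eq_zero_of_isUnit (hDu.pow 2)
  rw [hq, natDegree_quadratic (neg_ne_zero.2 h3)] at this
  omega

theorem irreducible_of_mul_X_sub_X_eq {K : Type*} [Field K] [IsAlgClosed K] {j : ℕ} (hj : j.Prime)
    (hj2 : 2 < j) (hK : ∀ n : ℕ, 0 < n → n ≤ j → (n : K) ≠ 0) {Φ : MvPolynomial (Fin 2) K}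
    (hΦ : Φ * (MvPolynomial.X 0 - MvPolynomial.X 1) =
      aeval (MvPolynomial.X 0) (∏ i ∈ Finset.Icc 1 j, (X + C (i : K)) : K[X]) -
        aeval (MvPolynomial.X 1) (∏ i ∈ Finset.Icc 1 j, (X + C (i : K)) : K[X])) :
    Irreducible Φ := by
  have : Fact j.Prime := ⟨hj⟩
  refine ⟨fun hu => ?_, fun A B hAB => ?_⟩
  · have h := congrArg (MvPolynomial.finSuccEquiv K 1) hΦ
    have hX1 : MvPolynomial.finSuccEquiv K 1 (MvPolynomial.X 1) = C (MvPolynomial.X 0) :=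
      MvPolynomial.finSuccEquiv_X_succ (j := 0)
    rw [finSuccEquiv_aeval_sub, map_mul, map_sub, MvPolynomial.finSuccEquiv_X_zero, hX1] at h
    have hd := congrArg natDegree h
    have hu' : IsUnit (MvPolynomial.finSuccEquiv K 1 Φ) := hu.map _
    have hdeg : (∏ i ∈ Finset.Icc 1 j, (X + C (i : K)) : K[X]).natDegree = j := by
      rw [natDegree_prod_of_monic _ _ fun i _ => monic_X_add_C _]
      simp only [natDegree_X_add_C]
      simp
    rw [natDegree_sub_C, natDegree_map, hdeg, natDegree_mul hu'.ne_zero (X_sub_C_ne_zero _),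
      natDegree_eq_zero_of_isUnit hu', natDegree_X_sub_C] at hd
    omega
  · rw [hAB] at hΦ
    obtain rfl | h3 := eq_or_ne j 3
    · have h2 := hK 2 (by omega) (by omega)
      have h3 := hK 3 (by omega) (by omega)
      push_cast at h2 h3
      exact isUnit_or_isUnit_of_three h2 h3 hΦ
    · obtain ⟨h, hh⟩ := hj.odd_of_ne_two (by omega)
      exact isUnit_or_isUnit_of_five_le hh (by omega) hK hΦ

end Polynomial

/-- **Lemma 7 (diagonal case).** For a large enough prime `p` and a prime `2 < j < p − 2`,
the polynomial `(P_j(x) − P_j(y))/(x − y)` is absolutely irreducible over `F_p`. -/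
theorem Pfact_quotient_absolutely_irreducible :
    ∃ p₀ : ℕ, ∀ (p : ℕ) [Fact p.Prime], p > p₀ →
      ∀ j : ℕ, j.Prime → 2 < j → j + 2 < p →
      ∀ φ : MvPolynomial (Fin 2) (ZMod p),
        φ * (X 0 - X 1) =
          Polynomial.aeval (X 0 : MvPolynomial (Fin 2) (ZMod p)) (Pfact p j) -
            Polynomial.aeval (X 1 : MvPolynomial (Fin 2) (ZMod p)) (Pfact p j) →
        Irreducible (MvPolynomial.map (algebraMap (ZMod p) (AlgebraicClosure (ZMod p))) φ) := by
  refine ⟨5, fun p _ _ j hj hj2 hjp φ hφ => ?_⟩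
  refine Polynomial.irreducible_of_mul_X_sub_X_eq hj hj2 (fun n hn hnj h0 => ?_) ?_
  · rw [CharP.cast_eq_zero_iff (AlgebraicClosure (ZMod p)) p] at h0
    exact absurd (Nat.le_of_dvd hn h0) (by omega)
  · have h := congrArg (MvPolynomial.map (algebraMap (ZMod p) (AlgebraicClosure (ZMod p)))) hφ
    simpa [Pfact] using h
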